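/- Let 0 < ε < 1 and let 𝒮 be a martingale ε-sparse family of triadic subintervals of [0,1). There exists a constant C(p) > 0, depending only on p and independent of k, ε, 𝒮, and the choices of the intervals I(J), such that for every triadic subinterval L of [0,1): Σ_{I ∈ 𝒮, I ⊆ L} ⟨w_k⟩_I^p·⟨σ_k⟩_I·|I| ≤ C(p)·w_k(L)/(1−ε) and Σ_{I ∈ 𝒮, I ⊆ L} ⟨σ_k⟩_I^{p'}·⟨w_k⟩_I·|I| ≤ C(p)·σ_k(L)/(1−ε), where p' := p/(p−1). -/

import Mathlib

open MeasureTheory Set Filter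

noncomputable section

namespace RTpaper

/-- The half-open interval `[a, b)` represented by the pair `(a, b)`. -/
def ivSet (I : ℝ × ℝ) : Set ℝ := Set.Ico I.1 I.2

/-- The length of the interval represented by `I`. -/
def len (I : ℝ × ℝ) : ℝ := I.2 - I.1

/-- The middle triadic child of an interval. -/
def mid (I : ℝ × ℝ) : ℝ × ℝ := (I.1 + (I.2 - I.1) / 3, I.2 - (I.2 - I.1) / 3)

/-- The families `𝐊ᵢ` of the Reguera–Thiele construction. -/
def Kfam (k : ℕ) : ℕ → Set (ℝ × ℝ)
  | 0 => {((0 : ℝ), (1 : ℝ))}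
  | (i + 1) =>
      {I | ∃ K ∈ Kfam k i, ∃ j : ℕ, j < 3 ^ (k - 1) ∧
        I = ((mid K).1 + (j : ℝ) * ((3 : ℝ) ^ (1 - (k : ℤ)) * len (mid K)),
             (mid K).1 + ((j : ℝ) + 1) * ((3 : ℝ) ^ (1 - (k : ℤ)) * len (mid K)))}

/-- The families `𝐉ᵢ` (of interest for `i ≥ 1`). -/
def Jfam (k i : ℕ) : Set (ℝ × ℝ) := {J | ∃ K ∈ Kfam k (i - 1), J = mid K}

/-- The family `𝐊 = ⋃ᵢ 𝐊ᵢ`. -/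
def KK (k : ℕ) : Set (ℝ × ℝ) := ⋃ i, Kfam k i

/-- The family `𝐉 = ⋃_{i ≥ 1} 𝐉ᵢ`. -/
def JJ (k : ℕ) : Set (ℝ × ℝ) := ⋃ i, Jfam k (i + 1)

/-- The chosen triadic interval `I(J)` adjacent to `J` of length `3^{1-k}|J|`, encoded by a
choice function `ch` deciding, for each `J`, whether `I(J)` lies to the right (`true`) or to
the left (`false`) of `J`. -/
def IJ (k : ℕ) (ch : ℝ × ℝ → Bool) (J : ℝ × ℝ) : ℝ × ℝ :=
  if ch J then (J.2, J.2 + (3 : ℝ) ^ (1 - (k : ℤ)) * len J)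
  else (J.1 - (3 : ℝ) ^ (1 - (k : ℤ)) * len J, J.1)

/-- The weight `w_k = Σ_{i ≥ 1} Σ_{J ∈ 𝐉ᵢ} (3^k/(3^{k-1}+1))^i · 1_{I(J)}`. -/
def wgt (k : ℕ) (ch : ℝ × ℝ → Bool) (x : ℝ) : ℝ :=
  ∑' i : ℕ, ∑' J : ↥(Jfam k (i + 1)),
    Set.indicator (ivSet (IJ k ch (J : ℝ × ℝ)))
      (fun _ => ((3 : ℝ) ^ k / ((3 : ℝ) ^ (k - 1) + 1)) ^ (i + 1)) x

/-- The weight `σ_k = w_k^{1-p}` on `{w_k > 0}`, and `0` elsewhere. -/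
def sgm (p : ℝ) (k : ℕ) (ch : ℝ × ℝ → Bool) (x : ℝ) : ℝ :=
  if 0 < wgt k ch x then wgt k ch x ^ (1 - p) else 0

/-- `u(I) = ∫_I u`. -/
def mass (u : ℝ → ℝ) (I : ℝ × ℝ) : ℝ := ∫ x in ivSet I, u x

/-- `⟨u⟩_I = u(I)/|I|`. -/
def avg (u : ℝ → ℝ) (I : ℝ × ℝ) : ℝ := mass u I / len I

/-- `ch_𝐊(K)`: the members of `𝐊_{i+1}` contained in `K ∈ 𝐊ᵢ`. -/
def chK (k : ℕ) (K : ℝ × ℝ) : Set (ℝ × ℝ) :=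
  {K' | ∃ i, K ∈ Kfam k i ∧ K' ∈ Kfam k (i + 1) ∧ ivSet K' ⊆ ivSet K}

/-- Triadic intervals of `ℝ`. -/
def IsTriadic (I : ℝ × ℝ) : Prop :=
  ∃ n j : ℤ, I.1 = (j : ℝ) * (3 : ℝ) ^ (-n) ∧ I.2 = ((j : ℝ) + 1) * (3 : ℝ) ^ (-n)

/-- Maximal members of `S` strictly contained in `R`. -/
def maxIn (S : Set (ℝ × ℝ)) (R : ℝ × ℝ) : Set (ℝ × ℝ) :=
  {Q | Q ∈ S ∧ ivSet Q ⊂ ivSet R ∧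
    ∀ Q' ∈ S, ivSet Q ⊆ ivSet Q' → ivSet Q' ⊂ ivSet R → ivSet Q' = ivSet Q}

/-- Martingale `ε`-sparse families of (half-open) intervals. -/
def MSparse (ε : ℝ) (S : Set (ℝ × ℝ)) : Prop :=
  S.Countable ∧ (∀ I ∈ S, I.1 < I.2) ∧
    (∀ I ∈ S, ∀ J ∈ S, ivSet I ⊆ ivSet J ∨ ivSet J ⊆ ivSet I ∨ ivSet I ∩ ivSet J = ∅) ∧
    ∀ R ∈ S, (∑' Q : ↥(maxIn S R), len (Q : ℝ × ℝ)) ≤ ε * len R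

/-- `Σ_{I ∈ F} ⟨u⟩_I^q · ⟨v⟩_I · |I|`. -/
def sumTest (q : ℝ) (u v : ℝ → ℝ) (F : Set (ℝ × ℝ)) : ℝ :=
  ∑' I : ↥F, avg u (I : ℝ × ℝ) ^ q * avg v (I : ℝ × ℝ) * len (I : ℝ × ℝ)


/-! ### Elementary facts on triadic intervals -/

theorem len_pos_of {I : ℝ × ℝ} (h : I.1 < I.2) : 0 < len I := by
  unfold len; linarith

theorem vol_iv (I : ℝ × ℝ) : volume (ivSet I) = ENNReal.ofReal (len I) := by
  unfold ivSet len; exact Real.volume_Ico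

theorem meas_iv (I : ℝ × ℝ) : MeasurableSet (ivSet I) := by
  unfold ivSet; exact measurableSet_Ico

theorem iv_inj {I J : ℝ × ℝ} (hI : I.1 < I.2) (h : ivSet I = ivSet J) : I = J := by
  unfold ivSet at h
  have h1 := (Set.Ico_subset_Ico_iff hI).1 h.le
  have hJ : J.1 < J.2 := by linarith
  have h2 := (Set.Ico_subset_Ico_iff hJ).1 h.ge
  exact Prod.ext (le_antisymm h2.1 h1.1) (le_antisymm h1.2 h2.2)

theorem iv_eq_of_len {I J : ℝ × ℝ} (hI : I.1 < I.2) (h : ivSet I ⊆ ivSet J)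
    (hl : len J ≤ len I) : I = J := by
  unfold ivSet at h
  have h1 := (Set.Ico_subset_Ico_iff hI).1 h
  unfold len at hl
  exact Prod.ext (by linarith) (by linarith)

theorem tri_pos {I : ℝ × ℝ} (h : IsTriadic I) : I.1 < I.2 := by
  obtain ⟨n, j, h1, h2⟩ := h
  rw [h1, h2]
  have : (0:ℝ) < 3 ^ (-n) := by positivity
  nlinarith

theorem tri_len {I : ℝ × ℝ} (h : IsTriadic I) : ∃ n : ℤ, len I = (3:ℝ) ^ (-n) := by
  obtain ⟨n, j, h1, h2⟩ := h
  exact ⟨n, by unfold len; rw [h1, h2]; ring⟩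

theorem tri_nest {P Q : ℝ × ℝ} (hP : IsTriadic P) (hQ : IsTriadic Q) (h : len P ≤ len Q) :
    ivSet P ⊆ ivSet Q ∨ Disjoint (ivSet P) (ivSet Q) := by
  obtain ⟨n, j, h1, h2⟩ := hP
  obtain ⟨m, l, h3, h4⟩ := hQ
  have hl : (3:ℝ) ^ (-n) ≤ 3 ^ (-m) := by
    have e1 : len P = (3:ℝ) ^ (-n) := by unfold len; rw [h1, h2]; ring
    have e2 : len Q = (3:ℝ) ^ (-m) := by unfold len; rw [h3, h4]; ring
    rwa [e1, e2] at h
  have hnm : -n ≤ -m := (zpow_le_zpow_iff_right₀ (by norm_num : (1:ℝ) < 3)).1 hl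
  obtain ⟨d, hd⟩ := Int.eq_ofNat_of_zero_le (show 0 ≤ n - m by omega)
  have hm : (3:ℝ) ^ (-m) = (((3:ℤ) ^ d : ℤ) : ℝ) * 3 ^ (-n) := by
    have : -m = (d:ℤ) + -n := by omega
    rw [this, zpow_add₀ (by norm_num)]
    push_cast; rw [zpow_natCast]
  have hpos : (0:ℝ) < 3 ^ (-n) := by positivity
  set s := (3:ℝ) ^ (-n)
  set e : ℤ := 3 ^ d
  unfold ivSet
  rw [h1, h2, h3, h4, hm]
  rcases lt_or_ge j (l * e) with c | c
  · right
    have c' : j + 1 ≤ l * e := c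
    have c'' : (j:ℝ) + 1 ≤ l * e := by exact_mod_cast c'
    rw [Set.Ico_disjoint_Ico]
    refine le_trans (min_le_left _ _) (le_trans ?_ (le_max_right _ _))
    nlinarith
  · rcases lt_or_ge j ((l + 1) * e) with c1 | c1
    · left
      have c' : j + 1 ≤ (l + 1) * e := c1
      have c'' : (j:ℝ) + 1 ≤ (l + 1) * e := by exact_mod_cast c'
      have c3 : (l:ℝ) * e ≤ j := by exact_mod_cast c
      apply Set.Ico_subset_Ico <;> nlinarith
    · right
      have c'' : ((l:ℝ) + 1) * e ≤ j := by exact_mod_cast c1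
      rw [Set.Ico_disjoint_Ico]
      refine le_trans (min_le_right _ _) (le_trans ?_ (le_max_left _ _))
      nlinarith

theorem tri_nest_of_mem {P Q : ℝ × ℝ} (hP : IsTriadic P) (hQ : IsTriadic Q)
    (h : len P ≤ len Q) {x : ℝ} (hx : x ∈ ivSet P) (hx' : x ∈ ivSet Q) : ivSet P ⊆ ivSet Q := by
  rcases tri_nest hP hQ h with c | c
  · exact c
  · exact absurd hx' (Set.disjoint_left.1 c hx)

/-! ### The construction -/

/-- Side length at level `i`. -/
def HH (k i : ℕ) : ℝ := ((3:ℝ) ^ (k * i))⁻¹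

theorem HH_pos (k i : ℕ) : 0 < HH k i := by unfold HH; positivity

theorem HH_succ (k i : ℕ) : HH k (i + 1) = HH k i * ((3:ℝ) ^ k)⁻¹ := by
  unfold HH; rw [Nat.mul_succ, pow_add, mul_inv]

theorem three_pow {k : ℕ} (hk : 1 ≤ k) : (3:ℝ) ^ k = 3 * 3 ^ (k - 1) := by
  obtain ⟨n, rfl⟩ := Nat.exists_eq_add_of_le hk
  simp [pow_add]

theorem three_zpow {k : ℕ} (hk : 1 ≤ k) : (3:ℝ) ^ (1 - (k:ℤ)) = ((3:ℝ) ^ (k - 1))⁻¹ := by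
  have : (1 - (k:ℤ)) = -((k - 1 : ℕ) : ℤ) := by omega
  rw [this, zpow_neg, zpow_natCast]

/-- The children of `K`. -/
def child (k : ℕ) (K : ℝ × ℝ) (j : ℕ) : ℝ × ℝ :=
  ((mid K).1 + (j : ℝ) * ((3 : ℝ) ^ (1 - (k : ℤ)) * len (mid K)),
    (mid K).1 + ((j : ℝ) + 1) * ((3 : ℝ) ^ (1 - (k : ℤ)) * len (mid K)))

theorem len_mid (K : ℝ × ℝ) : len (mid K) = len K / 3 := by
  unfold len mid; ring

theorem step_len {k : ℕ} (hk : 1 ≤ k) {i : ℕ} {K : ℝ × ℝ} (h : len K = HH k i) :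
    (3 : ℝ) ^ (1 - (k : ℤ)) * len (mid K) = HH k (i + 1) := by
  rw [len_mid, h, HH_succ, three_zpow hk, three_pow hk]
  field_simp

theorem mem_Kfam_succ {k i : ℕ} {I : ℝ × ℝ} :
    I ∈ Kfam k (i + 1) ↔ ∃ K ∈ Kfam k i, ∃ j : ℕ, j < 3 ^ (k - 1) ∧ I = child k K j := Iff.rfl

theorem Kfam_form {k : ℕ} (hk : 1 ≤ k) : ∀ {i : ℕ} {K : ℝ × ℝ}, K ∈ Kfam k i →
    ∃ m : ℕ, K = (m * HH k i, (m + 1) * HH k i) := by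
  intro i
  induction i with
  | zero =>
    intro K hK
    refine ⟨0, ?_⟩
    have : K = (0, 1) := hK
    simp [this, HH]
  | succ i ih =>
    intro K' hK'
    obtain ⟨K, hK, j, hj, rfl⟩ := mem_Kfam_succ.1 hK'
    obtain ⟨m, hm⟩ := ih hK
    have hl : len K = HH k i := by rw [hm]; unfold len; ring
    refine ⟨m * 3 ^ k + 3 ^ (k - 1) + j, ?_⟩
    unfold child
    rw [step_len hk hl]
    have h1 : (mid K).1 = (m * 3 ^ k + 3 ^ (k - 1)) * HH k (i + 1) := by
      rw [HH_succ, hm, three_pow hk]; unfold mid; field_simp; ring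
    rw [h1]
    push_cast
    ext <;> simp only [] <;> ring

theorem Kfam_len {k : ℕ} (hk : 1 ≤ k) {i : ℕ} {K : ℝ × ℝ} (hK : K ∈ Kfam k i) :
    len K = HH k i := by
  obtain ⟨m, rfl⟩ := Kfam_form hk hK
  unfold len; ring

theorem tri_of_form {k i : ℕ} (m : ℤ) {K : ℝ × ℝ} (h1 : K.1 = m * HH k i)
    (h2 : K.2 = (m + 1) * HH k i) : IsTriadic K := by
  refine ⟨((k * i : ℕ) : ℤ), m, ?_, ?_⟩
  · rw [h1, zpow_neg, zpow_natCast]; rfl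
  · rw [h2, zpow_neg, zpow_natCast]; rfl

theorem Kfam_tri {k : ℕ} (hk : 1 ≤ k) {i : ℕ} {K : ℝ × ℝ} (hK : K ∈ Kfam k i) :
    IsTriadic K := by
  obtain ⟨m, rfl⟩ := Kfam_form hk hK
  exact tri_of_form (k := k) (i := i) (m : ℤ) (by simp) (by simp)

theorem mid_tri {k : ℕ} (hk : 1 ≤ k) {i : ℕ} {K : ℝ × ℝ} (hK : K ∈ Kfam k i) :
    IsTriadic (mid K) := by
  obtain ⟨m, rfl⟩ := Kfam_form hk hK
  have : HH k i = 3 * (3:ℝ) ^ (-((k * i + 1 : ℕ) : ℤ)) := by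
    rw [zpow_neg, zpow_natCast, pow_succ]; unfold HH; field_simp
  refine ⟨((k * i + 1 : ℕ) : ℤ), 3 * m + 1, ?_, ?_⟩
  · unfold mid; rw [this]; push_cast; ring
  · unfold mid; rw [this]; push_cast; ring

theorem A_tri {k : ℕ} (hk : 1 ≤ k) {i : ℕ} {K : ℝ × ℝ} (hK : K ∈ Kfam k i)
    (ch : ℝ × ℝ → Bool) : IsTriadic (IJ k ch (mid K)) := by
  have hl := Kfam_len hk hK
  obtain ⟨m, hm⟩ := Kfam_form hk hK
  have h1 : (mid K).1 = (m * 3 ^ k + 3 ^ (k - 1)) * HH k (i + 1) := by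
    rw [HH_succ, hm, three_pow hk]; unfold mid; field_simp; ring
  have h2 : (mid K).2 = (m * 3 ^ k + 2 * 3 ^ (k - 1)) * HH k (i + 1) := by
    rw [HH_succ, hm, three_pow hk]; unfold mid; field_simp; ring
  unfold IJ
  rw [step_len hk hl, h1, h2]
  split_ifs
  · refine tri_of_form (k := k) (i := i + 1) (m * 3 ^ k + 2 * 3 ^ (k - 1)) ?_ ?_ <;> push_cast
    · rfl
    · ring
  · refine tri_of_form (k := k) (i := i + 1) (m * 3 ^ k + 3 ^ (k - 1) - 1) ?_ ?_ <;> push_cast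
    · ring
    · ring

theorem A_len {k : ℕ} (hk : 1 ≤ k) {i : ℕ} {K : ℝ × ℝ} (hK : K ∈ Kfam k i)
    (ch : ℝ × ℝ → Bool) : len (IJ k ch (mid K)) = HH k (i + 1) := by
  have hl := Kfam_len hk hK
  unfold IJ
  rw [step_len hk hl]
  split_ifs <;> unfold len <;> ring

theorem HH_succ_le {k : ℕ} (hk : 1 ≤ k) (i : ℕ) : HH k (i + 1) ≤ HH k i / 3 := by
  rw [HH_succ, three_pow hk]
  have h1 : (1:ℝ) ≤ 3 ^ (k - 1) := one_le_pow₀ (by norm_num)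
  have := HH_pos k i
  rw [mul_inv, div_eq_mul_inv]
  have h3 : ((3:ℝ) ^ (k - 1))⁻¹ ≤ 1 := inv_le_one_of_one_le₀ h1
  nlinarith

theorem A_sub {k : ℕ} (hk : 1 ≤ k) {i : ℕ} {K : ℝ × ℝ} (hK : K ∈ Kfam k i)
    (ch : ℝ × ℝ → Bool) : ivSet (IJ k ch (mid K)) ⊆ ivSet K := by
  have hl := Kfam_len hk hK
  have h3 := HH_succ_le hk i
  have hp := HH_pos k (i + 1)
  unfold IJ
  rw [step_len hk hl]
  unfold len at hl
  unfold ivSet mid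
  split_ifs <;> apply Set.Ico_subset_Ico <;> simp only [] <;> linarith

theorem A_disj (k : ℕ) (K : ℝ × ℝ) (ch : ℝ × ℝ → Bool) :
    Disjoint (ivSet (IJ k ch (mid K))) (ivSet (mid K)) := by
  unfold IJ ivSet
  split_ifs
  · rw [Set.disjoint_left]; intro x h1 h2
    simp only [Set.mem_Ico] at h1 h2; linarith
  · rw [Set.disjoint_left]; intro x h1 h2
    simp only [Set.mem_Ico] at h1 h2; linarith

theorem mid_sub {k : ℕ} (hk : 1 ≤ k) {i : ℕ} {K : ℝ × ℝ} (hK : K ∈ Kfam k i) :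
    ivSet (mid K) ⊆ ivSet K := by
  have hl := Kfam_len hk hK
  have hp := HH_pos k i
  unfold len at hl
  unfold ivSet mid
  apply Set.Ico_subset_Ico <;> simp only [] <;> linarith

theorem child_mem {k i : ℕ} {K : ℝ × ℝ} (hK : K ∈ Kfam k i) {j : ℕ} (hj : j < 3 ^ (k - 1)) :
    child k K j ∈ Kfam k (i + 1) := mem_Kfam_succ.2 ⟨K, hK, j, hj, rfl⟩

theorem pow_HH {k : ℕ} (hk : 1 ≤ k) (i : ℕ) : (3:ℝ) ^ (k - 1) * HH k (i + 1) = HH k i / 3 := by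
  rw [HH_succ, three_pow hk]; field_simp

theorem child_sub {k : ℕ} (hk : 1 ≤ k) {i : ℕ} {K : ℝ × ℝ} (hK : K ∈ Kfam k i) {j : ℕ}
    (hj : j < 3 ^ (k - 1)) : ivSet (child k K j) ⊆ ivSet (mid K) := by
  have hl := Kfam_len hk hK
  have hp := HH_pos k (i + 1)
  have hM := pow_HH hk i
  have hj' : (j:ℝ) + 1 ≤ 3 ^ (k - 1) := by exact_mod_cast hj
  have hjj : (0:ℝ) ≤ j := by positivity
  unfold child
  rw [step_len hk hl]
  have hm : (mid K).2 = (mid K).1 + HH k i / 3 := by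
    rw [← hl]; unfold mid len; ring
  unfold ivSet
  apply Set.Ico_subset_Ico <;> simp only []
  · nlinarith
  · rw [hm]; nlinarith

theorem mid_cover {k : ℕ} (hk : 1 ≤ k) {i : ℕ} {K : ℝ × ℝ} (hK : K ∈ Kfam k i) {x : ℝ}
    (hx : x ∈ ivSet (mid K)) : ∃ j : ℕ, j < 3 ^ (k - 1) ∧ x ∈ ivSet (child k K j) := by
  have hl := Kfam_len hk hK
  have hp := HH_pos k (i + 1)
  have hM := pow_HH hk i
  have hm : (mid K).2 = (mid K).1 + HH k i / 3 := by
    rw [← hl]; unfold mid len; ring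
  unfold ivSet at hx
  rw [Set.mem_Ico, hm] at hx
  have hy : 0 ≤ (x - (mid K).1) / HH k (i + 1) := div_nonneg (by linarith [hx.1]) hp.le
  have h1 := Nat.floor_le hy
  have h2 := Nat.lt_floor_add_one ((x - (mid K).1) / HH k (i + 1))
  rw [le_div_iff₀ hp] at h1
  rw [div_lt_iff₀ hp] at h2
  refine ⟨⌊(x - (mid K).1) / HH k (i + 1)⌋₊, ?_, ?_⟩
  · rw [Nat.floor_lt hy, div_lt_iff₀ hp]
    push_cast; linarith [hx.2]
  · unfold child ivSet
    rw [step_len hk hl]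
    constructor <;> simp only [] <;> linarith

theorem Kfam_uniq {k : ℕ} (hk : 1 ≤ k) {i : ℕ} {K K' : ℝ × ℝ} (hK : K ∈ Kfam k i)
    (hK' : K' ∈ Kfam k i) {x : ℝ} (hx : x ∈ ivSet K) (hx' : x ∈ ivSet K') : K = K' := by
  have hl : len K = len K' := by rw [Kfam_len hk hK, Kfam_len hk hK']
  exact iv_eq_of_len (tri_pos (Kfam_tri hk hK))
    (tri_nest_of_mem (Kfam_tri hk hK) (Kfam_tri hk hK') hl.le hx hx') hl.ge

theorem Kfam_anc {k : ℕ} (hk : 1 ≤ k) {i : ℕ} (d : ℕ) : ∀ {K : ℝ × ℝ}, K ∈ Kfam k (i + d) →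
    ∃ K' ∈ Kfam k i, ivSet K ⊆ ivSet K' := by
  induction d with
  | zero => intro K hK; exact ⟨K, hK, subset_rfl⟩
  | succ d ih =>
    intro K hK
    obtain ⟨K1, hK1, j, hj, rfl⟩ := mem_Kfam_succ.1 hK
    obtain ⟨K', h1, h2⟩ := ih hK1
    exact ⟨K', h1, ((child_sub hk hK1 hj).trans (mid_sub hk hK1)).trans h2⟩

/-- Localisation: a chosen interval meeting `K`. -/
theorem A_loc {k : ℕ} (hk : 1 ≤ k) {ch : ℝ × ℝ → Bool} {i j : ℕ} {K K' : ℝ × ℝ}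
    (hK : K ∈ Kfam k i) (hK' : K' ∈ Kfam k j) {x : ℝ} (hx : x ∈ ivSet K)
    (hx' : x ∈ ivSet (IJ k ch (mid K'))) :
    (i = j ∧ K' = K) ∨ (i < j ∧ x ∈ ivSet (mid K) ∧
      ∃ l : ℕ, l < 3 ^ (k - 1) ∧ x ∈ ivSet (child k K l)) := by
  have hx2 := A_sub hk hK' ch hx'
  rcases lt_trichotomy i j with c | c | c
  · right
    obtain ⟨d, rfl⟩ := Nat.exists_eq_add_of_lt c
    rw [show i + d + 1 = (i + 1) + d by ring] at hK'
    obtain ⟨K3, h3, hs⟩ := Kfam_anc hk d hK'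
    obtain ⟨K4, h4, l, hl, rfl⟩ := mem_Kfam_succ.1 h3
    have hx3 := hs hx2
    have hx4 := child_sub hk h4 hl hx3
    have : K4 = K := Kfam_uniq hk h4 hK (mid_sub hk h4 hx4) hx
    subst this
    exact ⟨c, hx4, l, hl, hx3⟩
  · left
    subst c
    exact ⟨rfl, Kfam_uniq hk hK' hK hx2 hx⟩
  · exfalso
    obtain ⟨d, rfl⟩ := Nat.exists_eq_add_of_lt c
    rw [show j + d + 1 = (j + 1) + d by ring] at hK
    obtain ⟨K3, h3, hs⟩ := Kfam_anc hk d hK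
    obtain ⟨K4, h4, l, hl, rfl⟩ := mem_Kfam_succ.1 h3
    have hx3 := hs hx
    have hx4 := child_sub hk h4 hl hx3
    have : K4 = K' := Kfam_uniq hk h4 hK' (mid_sub hk h4 hx4) hx2
    subst this
    exact Set.disjoint_left.1 (A_disj k K4 ch) hx' hx4

theorem A_uniq {k : ℕ} (hk : 1 ≤ k) {ch : ℝ × ℝ → Bool} {i j : ℕ} {K K' : ℝ × ℝ}
    (hK : K ∈ Kfam k i) (hK' : K' ∈ Kfam k j) {x : ℝ} (hx : x ∈ ivSet (IJ k ch (mid K)))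
    (hx' : x ∈ ivSet (IJ k ch (mid K'))) : i = j ∧ K' = K := by
  rcases A_loc hk hK hK' (A_sub hk hK ch hx) hx' with h | h
  · exact h
  · exact absurd h.2.1 (Set.disjoint_left.1 (A_disj k K ch) hx)

theorem Kfam_countable (k i : ℕ) : (Kfam k i).Countable := by
  induction i with
  | zero => exact Set.countable_singleton _
  | succ i ih =>
    have : Kfam k (i + 1) ⊆ ⋃ K ∈ Kfam k i, ⋃ j : ℕ, {child k K j} := by
      intro I hI
      obtain ⟨K, hK, j, hj, rfl⟩ := mem_Kfam_succ.1 hI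
      simp only [Set.mem_iUnion]
      exact ⟨K, hK, j, rfl⟩
    exact (ih.biUnion fun K _ => Set.countable_iUnion fun j => Set.countable_singleton _).mono this

theorem mid_inj {K K' : ℝ × ℝ} (h : mid K = mid K') : K = K' := by
  unfold mid at h
  have h1 := congrArg Prod.fst h
  have h2 := congrArg Prod.snd h
  simp only [] at h1 h2
  ext <;> linarith

/-! ### Weights of the given form -/

/-- `f` equals `α^(i+1)` on `I(J)`, `J ∈ 𝐉_{i+1}`, and vanishes elsewhere. -/
structure IsW (k : ℕ) (ch : ℝ × ℝ → Bool) (α : ℝ) (f : ℝ → ℝ) : Prop where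
  on : ∀ i K, K ∈ Kfam k i → ∀ x ∈ ivSet (IJ k ch (mid K)), f x = α ^ (i + 1)
  off : ∀ x, (∀ i K, K ∈ Kfam k i → x ∉ ivSet (IJ k ch (mid K))) → f x = 0

theorem wgt_isW {k : ℕ} (hk : 1 ≤ k) (ch : ℝ × ℝ → Bool) :
    IsW k ch ((3 : ℝ) ^ k / ((3 : ℝ) ^ (k - 1) + 1)) (wgt k ch) where
  on := by
    intro i K hK x hx
    unfold wgt
    rw [tsum_eq_single i]
    · rw [tsum_eq_single (⟨mid K, K, hK, rfl⟩ : ↥(Jfam k (i + 1)))]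
      · rw [Set.indicator_of_mem hx]
      · rintro ⟨J, K', hK', rfl⟩ hne
        apply Set.indicator_of_notMem
        intro hx'
        have := (A_uniq hk hK hK' hx hx').2
        exact hne (by simp only [this])
    · intro i' hi'
      have : ∀ J : ↥(Jfam k (i' + 1)), Set.indicator (ivSet (IJ k ch (J : ℝ × ℝ)))
          (fun _ => ((3 : ℝ) ^ k / ((3 : ℝ) ^ (k - 1) + 1)) ^ (i' + 1)) x = 0 := by
        rintro ⟨J, K', hK', rfl⟩
        apply Set.indicator_of_notMem
        intro hx'
        exact hi' (A_uniq hk hK hK' hx hx').1.symm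
      rw [tsum_congr this, tsum_zero]
  off := by
    intro x h
    unfold wgt
    have : ∀ i : ℕ, ∑' J : ↥(Jfam k (i + 1)), Set.indicator (ivSet (IJ k ch (J : ℝ × ℝ)))
          (fun _ => ((3 : ℝ) ^ k / ((3 : ℝ) ^ (k - 1) + 1)) ^ (i + 1)) x = 0 := by
      intro i
      have : ∀ J : ↥(Jfam k (i + 1)), Set.indicator (ivSet (IJ k ch (J : ℝ × ℝ)))
          (fun _ => ((3 : ℝ) ^ k / ((3 : ℝ) ^ (k - 1) + 1)) ^ (i + 1)) x = 0 := by
        rintro ⟨J, K', hK', rfl⟩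
        exact Set.indicator_of_notMem (h i K' hK') _
      rw [tsum_congr this, tsum_zero]
    rw [tsum_congr this, tsum_zero]

theorem sgm_isW {k : ℕ} (hk : 1 ≤ k) (ch : ℝ × ℝ → Bool) (p : ℝ) :
    IsW k ch (((3 : ℝ) ^ k / ((3 : ℝ) ^ (k - 1) + 1)) ^ (1 - p)) (sgm p k ch) where
  on := by
    intro i K hK x hx
    have ha : 0 < ((3 : ℝ) ^ k / ((3 : ℝ) ^ (k - 1) + 1)) := by positivity
    unfold sgm
    rw [(wgt_isW hk ch).on i K hK x hx, if_pos (by positivity)]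
    generalize ((3 : ℝ) ^ k / ((3 : ℝ) ^ (k - 1) + 1)) = a at ha
    rw [← Real.rpow_natCast, ← Real.rpow_natCast, ← Real.rpow_mul ha.le, ← Real.rpow_mul ha.le, mul_comm]
  off := by
    intro x h
    unfold sgm
    rw [(wgt_isW hk ch).off x h, if_neg (lt_irrefl _)]

/-- Index type of all intervals of `𝐊`. -/
abbrev Idx (k : ℕ) := Σ i : ℕ, ↥(Kfam k i)

theorem idx_countable (k : ℕ) : Countable (Idx k) := by
  have : ∀ i, Countable ↥(Kfam k i) := fun i => (Kfam_countable k i).to_subtype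
  infer_instance

/-- The chosen interval of an index. -/
def AA (k : ℕ) (ch : ℝ × ℝ → Bool) (κ : Idx k) : ℝ × ℝ := IJ k ch (mid κ.2)

theorem AA_uniq {k : ℕ} (hk : 1 ≤ k) {ch : ℝ × ℝ → Bool} {κ κ' : Idx k} {x : ℝ}
    (hx : x ∈ ivSet (AA k ch κ)) (hx' : x ∈ ivSet (AA k ch κ')) : κ' = κ := by
  obtain ⟨i, K, hK⟩ := κ
  obtain ⟨j, K', hK'⟩ := κ'
  obtain ⟨h1, h2⟩ := A_uniq hk hK hK' hx hx'
  subst h1; subst h2; rfl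

section

variable {k : ℕ} {ch : ℝ × ℝ → Bool} {α : ℝ} {f : ℝ → ℝ}

theorem IsW.nonneg (hf : IsW k ch α f) (hα : 0 < α) (x : ℝ) : 0 ≤ f x := by
  by_cases h : ∀ i K, K ∈ Kfam k i → x ∉ ivSet (IJ k ch (mid K))
  · rw [hf.off x h]
  · push Not at h
    obtain ⟨i, K, hK, hx⟩ := h
    rw [hf.on i K hK x hx]; positivity

theorem IsW.eq_tsum (hk : 1 ≤ k) (hf : IsW k ch α f) (x : ℝ) : ENNReal.ofReal (f x) =
    ∑' κ : Idx k, (ivSet (AA k ch κ)).indicator (fun _ => ENNReal.ofReal (α ^ (κ.1 + 1))) x := by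
  by_cases h : ∀ i K, K ∈ Kfam k i → x ∉ ivSet (IJ k ch (mid K))
  · rw [hf.off x h]
    have : ∀ κ : Idx k, (ivSet (AA k ch κ)).indicator
        (fun _ => ENNReal.ofReal (α ^ (κ.1 + 1))) x = 0 := by
      rintro ⟨i, K, hK⟩
      exact Set.indicator_of_notMem (h i K hK) _
    rw [tsum_congr this, tsum_zero]; simp
  · push Not at h
    obtain ⟨i, K, hK, hx⟩ := h
    rw [hf.on i K hK x hx, tsum_eq_single (⟨i, K, hK⟩ : Idx k)]
    · rw [Set.indicator_of_mem (show x ∈ ivSet (AA k ch ⟨i, K, hK⟩) from hx)]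
    · intro κ' hne
      apply Set.indicator_of_notMem
      intro hx'
      exact hne (AA_uniq hk (κ := ⟨i, K, hK⟩) hx hx')

theorem IsW.measurable (hk : 1 ≤ k) (hf : IsW k ch α f) (hα : 0 < α) : Measurable f := by
  have := idx_countable k
  have h1 : f = fun x => (∑' κ : Idx k, (ivSet (AA k ch κ)).indicator
      (fun _ => ENNReal.ofReal (α ^ (κ.1 + 1))) x).toReal := by
    funext x
    rw [← hf.eq_tsum hk x, ENNReal.toReal_ofReal (hf.nonneg hα x)]
  rw [h1]
  apply Measurable.ennreal_toReal
  apply Measurable.tsum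
  intro κ
  exact measurable_const.indicator (meas_iv _)

/-- The measure with density `f`. -/
def nu (f : ℝ → ℝ) : Measure ℝ := volume.withDensity (fun x => ENNReal.ofReal (f x))

theorem nu_apply (f : ℝ → ℝ) {s : Set ℝ} (hs : MeasurableSet s) :
    nu f s = ∫⁻ x in s, ENNReal.ofReal (f x) := withDensity_apply _ hs

theorem mass_eq (hk : 1 ≤ k) (hf : IsW k ch α f) (hα : 0 < α) (I : ℝ × ℝ) :
    mass f I = (nu f (ivSet I)).toReal := by
  unfold mass
  rw [nu_apply _ (meas_iv I), integral_eq_lintegral_of_nonneg_ae]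
  · exact Filter.Eventually.of_forall (hf.nonneg hα)
  · exact (hf.measurable hk hα).aestronglyMeasurable

theorem nu_on (hf : IsW k ch α f) {i : ℕ} {K : ℝ × ℝ} (hK : K ∈ Kfam k i) {s : Set ℝ}
    (hs : MeasurableSet s) (h : s ⊆ ivSet (IJ k ch (mid K))) :
    nu f s = ENNReal.ofReal (α ^ (i + 1)) * volume s := by
  rw [nu_apply _ hs, ← setLIntegral_const]
  apply setLIntegral_congr_fun hs
  intro x hx
  simp only [hf.on i K hK x (h hx)]

theorem nu_off (hf : IsW k ch α f) {s : Set ℝ} (hs : MeasurableSet s)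
    (h : ∀ x ∈ s, ∀ i K, K ∈ Kfam k i → x ∉ ivSet (IJ k ch (mid K))) : nu f s = 0 := by
  rw [nu_apply _ hs]
  have : ∫⁻ x in s, ENNReal.ofReal (f x) = ∫⁻ x in s, 0 := by
    apply setLIntegral_congr_fun hs
    intro x hx
    simp only [hf.off x (h x hx), ENNReal.ofReal_zero]
  rw [this]; simp

/-- Union of chosen intervals of level `< N`. -/
def DD (k : ℕ) (ch : ℝ × ℝ → Bool) (N : ℕ) : Set ℝ :=
  {x | ∃ i K, i < N ∧ K ∈ Kfam k i ∧ x ∈ ivSet (IJ k ch (mid K))}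

theorem DD_meas (k : ℕ) (ch : ℝ × ℝ → Bool) (N : ℕ) : MeasurableSet (DD k ch N) := by
  have := idx_countable k
  have h : DD k ch N = ⋃ κ : Idx k, ⋃ _ : κ.1 < N, ivSet (AA k ch κ) := by
    ext x
    simp only [DD, Set.mem_ofPred_eq, Set.mem_iUnion]
    constructor
    · rintro ⟨i, K, h1, h2, h3⟩
      exact ⟨⟨i, K, h2⟩, h1, h3⟩
    · rintro ⟨⟨i, K, h2⟩, h1, h3⟩
      exact ⟨i, K, h1, h2, h3⟩
  rw [h]
  exact MeasurableSet.iUnion fun κ => MeasurableSet.iUnion fun _ => meas_iv _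

theorem nu_K_trunc (hk : 1 ≤ k) (hf : IsW k ch α f) (hα : 0 < α) {C : ℝ} (hC : 0 < C)
    (hCα : α * (1 + 3 ^ (k - 1) * C) ≤ 3 ^ k * C) (d : ℕ) : ∀ {i : ℕ} {K : ℝ × ℝ},
    K ∈ Kfam k i → nu f (ivSet K ∩ DD k ch (i + d)) ≤ ENNReal.ofReal (C * α ^ i * HH k i) := by
  induction d with
  | zero =>
    intro i K hK
    have : ivSet K ∩ DD k ch (i + 0) = ∅ := by
      ext x
      simp only [Set.mem_inter_iff, Set.mem_empty_iff_false, iff_false, not_and]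
      rintro hx ⟨j, K', hj, hK', hx'⟩
      rcases A_loc hk hK hK' hx hx' with h | h <;> omega
    rw [this]; simp
  | succ d ih =>
    intro i K hK
    have hsub : ivSet K ∩ DD k ch (i + (d + 1)) ⊆ ivSet (IJ k ch (mid K)) ∪
        ⋃ l ∈ Finset.range (3 ^ (k - 1)), (ivSet (child k K l) ∩ DD k ch ((i + 1) + d)) := by
      rintro x ⟨hx, j, K', hj, hK', hx'⟩
      rcases A_loc hk hK hK' hx hx' with h | ⟨h1, h2, l, hl, h3⟩
      · left; rw [h.2] at hx'; exact hx'
      · right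
        simp only [Set.mem_iUnion, Finset.mem_range]
        exact ⟨l, hl, h3, j, K', by omega, hK', hx'⟩
    refine (measure_mono hsub).trans ((measure_union_le _ _).trans ?_)
    have h1 : nu f (ivSet (IJ k ch (mid K))) = ENNReal.ofReal (α ^ (i + 1) * HH k (i + 1)) := by
      rw [nu_on hf hK (meas_iv _) subset_rfl, vol_iv, A_len hk hK,
        ENNReal.ofReal_mul (by positivity)]
    have h2 : nu f (⋃ l ∈ Finset.range (3 ^ (k - 1)),
        (ivSet (child k K l) ∩ DD k ch ((i + 1) + d))) ≤
        ENNReal.ofReal (3 ^ (k - 1) * (C * α ^ (i + 1) * HH k (i + 1))) := by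
      refine (measure_biUnion_finset_le _ _).trans ?_
      refine (Finset.sum_le_sum (fun l hl => ih (child_mem hK (Finset.mem_range.1 hl)))).trans ?_
      rw [Finset.sum_const, Finset.card_range, nsmul_eq_mul,
        ENNReal.ofReal_mul (p := (3:ℝ) ^ (k - 1)) (by positivity)]
      apply le_of_eq
      congr 1
      rw [ENNReal.ofReal_pow (by norm_num)]
      simp
    rw [h1]
    refine (add_le_add le_rfl h2).trans ?_
    have hp := HH_pos k (i + 1)
    rw [← ENNReal.ofReal_add (by positivity) (by positivity)]
    apply ENNReal.ofReal_le_ofReal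
    have e : HH k i = 3 ^ k * HH k (i + 1) := by rw [HH_succ]; field_simp
    rw [e, pow_succ]
    have hx : 0 ≤ α ^ i * HH k (i + 1) := by positivity
    nlinarith [mul_le_mul_of_nonneg_right hCα hx]

theorem nu_K (hk : 1 ≤ k) (hf : IsW k ch α f) (hα : 0 < α) {C : ℝ} (hC : 0 < C)
    (hCα : α * (1 + 3 ^ (k - 1) * C) ≤ 3 ^ k * C) {i : ℕ} {K : ℝ × ℝ}
    (hK : K ∈ Kfam k i) : nu f (ivSet K) ≤ ENNReal.ofReal (C * α ^ i * HH k i) := by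
  have hsub : ivSet K ⊆ (⋃ d, (ivSet K ∩ DD k ch (i + d))) ∪ (ivSet K \ ⋃ N, DD k ch N) := by
    intro x hx
    by_cases h : x ∈ ⋃ N, DD k ch N
    · left
      obtain ⟨N, hN⟩ := Set.mem_iUnion.1 h
      obtain ⟨j, K', hj, h'⟩ := hN
      exact Set.mem_iUnion.2 ⟨N, hx, j, K', by omega, h'⟩
    · right; exact ⟨hx, h⟩
  refine (measure_mono hsub).trans ((measure_union_le _ _).trans ?_)
  have h0 : nu f (ivSet K \ ⋃ N, DD k ch N) = 0 := by
    apply nu_off hf ((meas_iv _).diff (MeasurableSet.iUnion (DD_meas k ch)))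
    rintro x ⟨_, hx⟩ j K' hK' hx'
    exact hx (Set.mem_iUnion.2 ⟨j + 1, j, K', by omega, hK', hx'⟩)
  rw [h0, add_zero, Monotone.measure_iUnion]
  · exact iSup_le fun d => nu_K_trunc hk hf hα hC hCα d hK
  · intro d d' hd x hx
    obtain ⟨hx, j, K', hj, hmem⟩ := hx
    exact ⟨hx, j, K', by omega, hmem⟩

/-- Intervals inside the middle third not contained in a child. -/
theorem nu_mid (hk : 1 ≤ k) (hf : IsW k ch α f) (hα : 0 < α) {C : ℝ} (hC : 0 < C)
    (hCα : α * (1 + 3 ^ (k - 1) * C) ≤ 3 ^ k * C) {i : ℕ} {K : ℝ × ℝ}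
    (hK : K ∈ Kfam k i) {I : ℝ × ℝ} (hI : ivSet I ⊆ ivSet (mid K))
    (hch : ∀ l, l < 3 ^ (k - 1) → ∀ x ∈ ivSet I, x ∈ ivSet (child k K l) →
      ivSet (child k K l) ⊆ ivSet I) :
    nu f (ivSet I) ≤ ENNReal.ofReal (C * α ^ (i + 1) * len I) := by
  classical
  set T := (Finset.range (3 ^ (k - 1))).filter (fun l => ivSet (child k K l) ⊆ ivSet I)
  have hT : ∀ l ∈ T, l < 3 ^ (k - 1) ∧ ivSet (child k K l) ⊆ ivSet I := by
    intro l hl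
    simpa [T] using hl
  have hsub : ivSet I ⊆ ⋃ l ∈ T, ivSet (child k K l) := by
    intro x hx
    obtain ⟨l, hl, hxl⟩ := mid_cover hk hK (hI hx)
    simp only [Set.mem_iUnion]
    exact ⟨l, by simp only [T, Finset.mem_filter, Finset.mem_range]; exact ⟨hl, hch l hl x hx hxl⟩, hxl⟩
  refine (measure_mono hsub).trans ((measure_biUnion_finset_le _ _).trans ?_)
  refine (Finset.sum_le_sum
    (fun l hl => nu_K hk hf hα hC hCα (child_mem hK (hT l hl).1))).trans ?_
  have e : ∀ l ∈ T, ENNReal.ofReal (C * α ^ (i + 1) * HH k (i + 1)) =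
      ENNReal.ofReal (C * α ^ (i + 1)) * volume (ivSet (child k K l)) := by
    intro l hl
    rw [vol_iv, Kfam_len hk (child_mem hK (hT l hl).1), ENNReal.ofReal_mul (by positivity)]
  rw [Finset.sum_congr rfl e, ← Finset.mul_sum,
    ENNReal.ofReal_mul (p := C * α ^ (i + 1)) (by positivity), ← vol_iv]
  gcongr
  rw [← measure_biUnion_finset]
  · apply measure_mono
    exact Set.iUnion₂_subset fun l hl => (hT l hl).2
  · intro l hl l' hl' hne
    rw [Function.onFun, Set.disjoint_left]
    intro x hx hx'
    have := Kfam_uniq hk (child_mem hK (hT l hl).1) (child_mem hK (hT l' hl').1) hx hx'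
    unfold child at this
    rw [step_len hk (Kfam_len hk hK)] at this
    have h1 := congrArg Prod.fst this
    simp only [add_right_inj] at h1
    have h2 := mul_right_cancel₀ (HH_pos k (i + 1)).ne' h1
    exact hne (by exact_mod_cast h2)
  · intro l _; exact meas_iv _

/-- Intervals inside `K` disjoint from the middle third. -/
theorem nu_side (hk : 1 ≤ k) (hf : IsW k ch α f) {i : ℕ} {K : ℝ × ℝ}
    (hK : K ∈ Kfam k i) {I : ℝ × ℝ} (hI : ivSet I ⊆ ivSet K)
    (hd : Disjoint (ivSet I) (ivSet (mid K))) :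
    nu f (ivSet I) ≤ ENNReal.ofReal (α ^ (i + 1)) *
      volume (ivSet I ∩ ivSet (IJ k ch (mid K))) := by
  rw [← nu_on hf hK ((meas_iv _).inter (meas_iv _)) Set.inter_subset_right]
  rw [← measure_inter_add_sdiff (ivSet I) (meas_iv (IJ k ch (mid K)))]
  have : nu f (ivSet I \ ivSet (IJ k ch (mid K))) = 0 := by
    apply nu_off hf ((meas_iv _).diff (meas_iv _))
    rintro x ⟨hx, hxn⟩ j K' hK' hx'
    rcases A_loc hk hK hK' (hI hx) hx' with h | h
    · rw [h.2] at hx'; exact hxn hx'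
    · exact Set.disjoint_left.1 hd hx h.2.1
  rw [this, add_zero]

/-! ### Sparse families -/

/-- The part of `I` not covered by smaller members of `S`. -/
def EE (S : Set (ℝ × ℝ)) (I : ℝ × ℝ) : Set ℝ :=
  ivSet I \ ⋃ Q ∈ {Q | Q ∈ S ∧ ivSet Q ⊂ ivSet I}, ivSet Q

theorem EE_meas {S : Set (ℝ × ℝ)} (hS : S.Countable) (I : ℝ × ℝ) : MeasurableSet (EE S I) := by
  refine (meas_iv I).diff (MeasurableSet.biUnion (hS.mono ?_) fun Q _ => meas_iv Q)
  intro Q hQ; exact hQ.1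

theorem EE_sub (S : Set (ℝ × ℝ)) (I : ℝ × ℝ) : EE S I ⊆ ivSet I := Set.sdiff_subset

theorem EE_disj {ε : ℝ} {S : Set (ℝ × ℝ)} (hS : MSparse ε S) {I J : ℝ × ℝ} (hI : I ∈ S)
    (hJ : J ∈ S) (hne : I ≠ J) : Disjoint (EE S I) (EE S J) := by
  have hne' : ivSet I ≠ ivSet J := fun h => hne (iv_inj (hS.2.1 I hI) h)
  rw [Set.disjoint_left]
  rintro x ⟨hx, hxn⟩ ⟨hy, hyn⟩
  rcases hS.2.2.1 I hI J hJ with h | h | h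
  · exact hyn (Set.mem_biUnion (show I ∈ {Q | Q ∈ S ∧ ivSet Q ⊂ ivSet J} from
      ⟨hI, h.ssubset_of_ne hne'⟩) hx)
  · exact hxn (Set.mem_biUnion (show J ∈ {Q | Q ∈ S ∧ ivSet Q ⊂ ivSet I} from
      ⟨hJ, h.ssubset_of_ne hne'.symm⟩) hy)
  · have : x ∈ ivSet I ∩ ivSet J := ⟨hx, hy⟩
    rw [h] at this; exact this

theorem len_le_of_sub {I J : ℝ × ℝ} (hI : I.1 < I.2) (h : ivSet I ⊆ ivSet J) :
    len I ≤ len J := by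
  have := (Set.Ico_subset_Ico_iff hI).1 h
  unfold len; linarith

theorem exists_max {S : Set (ℝ × ℝ)} (hT : ∀ I ∈ S, IsTriadic I) {I Q : ℝ × ℝ} 
    (hQ : Q ∈ S) (hQI : ivSet Q ⊂ ivSet I) : ∃ R ∈ maxIn S I, ivSet Q ⊆ ivSet R := by
  have hQp := tri_pos (hT Q hQ)
  obtain ⟨nQ, hnQ⟩ := tri_len (hT Q hQ)
  let P : ℕ → Prop := fun m => ∃ R ∈ S, ivSet R ⊂ ivSet I ∧ ivSet Q ⊆ ivSet R ∧
    len R = (3:ℝ) ^ m * len Q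
  -- boundedness of lengths
  have hb : ∃ B : ℕ, ∀ m, P m → m ≤ B := by
    obtain ⟨B, hB⟩ := pow_unbounded_of_one_lt (len I / len Q) (by norm_num : (1:ℝ) < 3)
    refine ⟨B, ?_⟩
    rintro m ⟨R, hR, h1, h2, h3⟩
    by_contra hm
    push Not at hm
    have hl := len_le_of_sub (tri_pos (hT R hR)) h1.subset
    have hq := len_pos_of hQp
    rw [div_lt_iff₀ hq] at hB
    have : (3:ℝ) ^ B ≤ 3 ^ m := pow_le_pow_right₀ (by norm_num) hm.le
    nlinarith
  obtain ⟨B, hB⟩ := hb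
  classical
  have hP0 : P 0 := ⟨Q, hQ, hQI, subset_rfl, by simp⟩
  have hPs := Nat.findGreatest_spec (P := P) (Nat.zero_le B) hP0
  obtain ⟨R, hR, h1, h2, h3⟩ := hPs
  refine ⟨R, ⟨hR, h1, ?_⟩, h2⟩
  intro R' hR' hs hs'
  have hl := len_le_of_sub (tri_pos (hT R hR)) hs
  obtain ⟨n', hn'⟩ := tri_len (hT R' hR')
  have hq' := len_le_of_sub hQp (h2.trans hs)
  have hle : -nQ ≤ -n' := by
    rw [hnQ, hn'] at hq'
    exact (zpow_le_zpow_iff_right₀ (by norm_num : (1:ℝ) < 3)).1 hq'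
  obtain ⟨d, hd⟩ := Int.eq_ofNat_of_zero_le (show 0 ≤ nQ - n' by omega)
  have hPd : P d := by
    refine ⟨R', hR', hs', h2.trans hs, ?_⟩
    rw [hn', hnQ, ← zpow_natCast, ← zpow_add₀ (by norm_num)]
    congr 1; omega
  have hdle := Nat.le_findGreatest (hB d hPd) hPd
  have hlen : len R' ≤ len R := by
    obtain ⟨_, _, _, _, h5⟩ := hPd
    rw [h3]
    have e : len R' = (3:ℝ) ^ d * len Q := by
      rw [hn', hnQ, ← zpow_natCast, ← zpow_add₀ (by norm_num)]
      congr 1; omega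
    rw [e]
    have := len_pos_of hQp
    gcongr
    norm_num
  rw [iv_eq_of_len (tri_pos (hT R hR)) hs hlen]

theorem EE_vol {ε : ℝ} (hε : 0 < ε) {S : Set (ℝ × ℝ)} (hS : MSparse ε S)
    (hT : ∀ I ∈ S, IsTriadic I) {I : ℝ × ℝ} (hI : I ∈ S) :
    ENNReal.ofReal ((1 - ε) * len I) ≤ volume (EE S I) := by
  have hIp := len_pos_of (tri_pos (hT I hI))
  have hcnt : Countable ↥(maxIn S I) := (hS.1.mono fun Q hQ => hQ.1).to_subtype
  have hdis : Pairwise (Function.onFun Disjoint fun Q : ↥(maxIn S I) => ivSet (Q : ℝ × ℝ)) := by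
    rintro ⟨Q, hQ⟩ ⟨R, hR⟩ hne
    have hne' : ivSet Q ≠ ivSet R := fun h =>
      hne (Subtype.ext (iv_inj (hS.2.1 Q hQ.1) h))
    rcases hS.2.2.1 Q hQ.1 R hR.1 with h | h | h
    · exact absurd (hQ.2.2 R hR.1 h hR.2.1).symm hne'
    · exact absurd (hR.2.2 Q hQ.1 h hQ.2.1) hne'
    · exact Set.disjoint_iff_inter_eq_empty.2 h
  have hsum : volume (⋃ Q : ↥(maxIn S I), ivSet (Q : ℝ × ℝ)) =
      ∑' Q : ↥(maxIn S I), ENNReal.ofReal (len (Q : ℝ × ℝ)) := by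
    rw [measure_iUnion hdis fun Q => meas_iv _]
    exact tsum_congr fun Q => vol_iv _
  have hle : volume (⋃ Q : ↥(maxIn S I), ivSet (Q : ℝ × ℝ)) ≤ ENNReal.ofReal (len I) := by
    rw [← vol_iv]
    exact measure_mono (Set.iUnion_subset fun Q => Q.2.2.1.subset)
  have hnn : ∀ Q : ↥(maxIn S I), 0 ≤ len (Q : ℝ × ℝ) := fun Q =>
    (len_pos_of (hS.2.1 _ Q.2.1)).le
  have hfin : ∑' Q : ↥(maxIn S I), ENNReal.ofReal (len (Q : ℝ × ℝ)) ≠ ⊤ := by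
    rw [← hsum]; exact (hle.trans_lt ENNReal.ofReal_lt_top).ne
  have hsm : Summable fun Q : ↥(maxIn S I) => len (Q : ℝ × ℝ) := by
    have := ENNReal.summable_toReal hfin
    refine this.congr fun Q => ?_
    rw [ENNReal.toReal_ofReal (hnn Q)]
  have hε' : volume (⋃ Q : ↥(maxIn S I), ivSet (Q : ℝ × ℝ)) ≤ ENNReal.ofReal (ε * len I) := by
    rw [hsum, ← ENNReal.ofReal_tsum_of_nonneg hnn hsm]
    exact ENNReal.ofReal_le_ofReal (hS.2.2.2 I hI)
  have hsub : ivSet I \ (⋃ Q : ↥(maxIn S I), ivSet (Q : ℝ × ℝ)) ⊆ EE S I := by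
    rintro x ⟨hx, hxn⟩
    refine ⟨hx, fun h => hxn ?_⟩
    simp only [Set.mem_iUnion] at h
    obtain ⟨Q, ⟨hQ, hQI⟩, hxQ⟩ := h
    obtain ⟨R, hR, hs⟩ := exists_max hT hQ hQI
    exact Set.mem_iUnion.2 ⟨⟨R, hR⟩, hs hxQ⟩
  refine le_trans ?_ (measure_mono hsub)
  refine le_trans ?_ le_measure_sdiff
  rw [vol_iv]
  refine le_trans ?_ (tsub_le_tsub_left hε' _)
  rw [← ENNReal.ofReal_sub _ (by positivity)]
  apply ENNReal.ofReal_le_ofReal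
  linarith

/-! ### Pointwise bound -/

theorem avg_le (hk : 1 ≤ k) (hf : IsW k ch α f) (hα : 0 < α) {I : ℝ × ℝ} (hI : I.1 < I.2)
    {B : ℝ} (hB : 0 ≤ B) (h : nu f (ivSet I) ≤ ENNReal.ofReal (B * len I)) : avg f I ≤ B := by
  have hl := len_pos_of hI
  unfold avg
  rw [mass_eq hk hf hα, div_le_iff₀ hl]
  exact ENNReal.toReal_le_of_le_ofReal (by positivity) h

theorem avg_nonneg (hk : 1 ≤ k) (hf : IsW k ch α f) (hα : 0 < α) {I : ℝ × ℝ} (hI : I.1 < I.2) :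
    0 ≤ avg f I := by
  have hl := len_pos_of hI
  unfold avg
  rw [mass_eq hk hf hα]
  positivity

theorem calc_t {α β q x y s t : ℝ} (hα : 0 < α) (hβ : 0 < β) (hq : 1 < q)
    (hαβ : α ^ q * β = α) (hx : 0 ≤ x) (hs : 0 ≤ s) (ht : 0 ≤ t) {m : ℕ}
    (h1 : s ≤ x * α ^ m) (h2 : t ≤ y * β ^ m) : s ^ q * t ≤ x ^ q * y * α ^ m := by
  have h3 : s ^ q ≤ (x * α ^ m) ^ q := Real.rpow_le_rpow hs h1 (by linarith)
  have h4 : (x * α ^ m) ^ q = x ^ q * (α ^ q) ^ m := by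
    rw [Real.mul_rpow hx (by positivity)]
    congr 1
    rw [← Real.rpow_natCast, ← Real.rpow_natCast, ← Real.rpow_mul hα.le, ← Real.rpow_mul hα.le,
      mul_comm]
  have h5 : 0 ≤ (x * α ^ m) ^ q := by positivity
  calc s ^ q * t ≤ (x * α ^ m) ^ q * (y * β ^ m) := mul_le_mul h3 h2 ht h5
    _ = x ^ q * y * (α ^ q * β) ^ m := by rw [h4, mul_pow]; ring
    _ = _ := by rw [hαβ]

/-- The Cauchy kernel attached to an index. -/
def PP (k : ℕ) (ch : ℝ × ℝ → Bool) (κ : Idx k) (x : ℝ) : ℝ :=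
  (1 + ((x - (AA k ch κ).1) / HH k (κ.1 + 1)) ^ 2)⁻¹

/-- Majorant attached to an index. -/
def TT (k : ℕ) (ch : ℝ × ℝ → Bool) (α E : ℝ) (κ : Idx k) (x : ℝ) : ℝ :=
  α ^ (κ.1 + 1) * (E * ((3:ℝ) ^ k)⁻¹ * (ivSet (κ.2 : ℝ × ℝ)).indicator 1 x + 2 * PP k ch κ x)

theorem PP_nonneg (κ : Idx k) (x : ℝ) : 0 ≤ PP k ch κ x := by
  unfold PP; positivity

theorem HH_small {k : ℕ} (hk : 1 ≤ k) {l : ℝ} (hl : 0 < l) : ∃ n, HH k n < l := by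
  obtain ⟨n, hn⟩ := exists_pow_lt_of_lt_one hl (by norm_num : (3:ℝ)⁻¹ < 1)
  refine ⟨n, lt_of_le_of_lt ?_ hn⟩
  unfold HH
  rw [inv_pow]
  apply inv_anti₀ (by positivity)
  exact pow_le_pow_right₀ (by norm_num) (Nat.le_mul_of_pos_left n hk)

theorem pointwise {k : ℕ} (hk : 1 ≤ k) {ch : ℝ × ℝ → Bool} {α β q : ℝ} {u v : ℝ → ℝ}
    (hu : IsW k ch α u) (hv : IsW k ch β v) (hα : 0 < α) (hβ : 0 < β) (hq : 1 < q)
    (hαβ : α ^ q * β = α) {Cu Cv E : ℝ} (hCu : 0 < Cu) (hCv : 0 < Cv) (hE : 0 ≤ E)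
    (hCuα : α * (1 + 3 ^ (k - 1) * Cu) ≤ 3 ^ k * Cu)
    (hCvβ : β * (1 + 3 ^ (k - 1) * Cv) ≤ 3 ^ k * Cv)
    (hD : Cu ^ q * Cv ≤ E * α * ((3:ℝ) ^ k)⁻¹)
    {I : ℝ × ℝ} (hI : IsTriadic I) (hI1 : ivSet I ⊆ Set.Ico (0:ℝ) 1) {x : ℝ} (hx : x ∈ ivSet I) :
    avg u I ^ q * avg v I ≤ u x ∨ ∃ κ : Idx k, ivSet (AA k ch κ) ⊆ ivSet I ∧
      avg u I ^ q * avg v I ≤ TT k ch α E κ x := by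
  have hIp := tri_pos hI
  have hlI := len_pos_of hIp
  have hu0 := avg_nonneg hk hu hα hIp
  have hv0 := avg_nonneg hk hv hβ hIp
  -- the case of a union of `K` of level `i`
  have key : ∀ (i : ℕ) (K : ℝ × ℝ) (hK : K ∈ Kfam k i), x ∈ ivSet K → ivSet K ⊆ ivSet I →
      nu u (ivSet I) ≤ ENNReal.ofReal (Cu * α ^ i * len I) →
      nu v (ivSet I) ≤ ENNReal.ofReal (Cv * β ^ i * len I) →
      ∃ κ : Idx k, ivSet (AA k ch κ) ⊆ ivSet I ∧
      avg u I ^ q * avg v I ≤ TT k ch α E κ x := by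
    intro i K hK hxK hKI h1 h2
    refine ⟨⟨i, K, hK⟩, (A_sub hk hK ch).trans hKI, ?_⟩
    have a1 := avg_le hk hu hα hIp (by positivity) h1
    have a2 := avg_le hk hv hβ hIp (by positivity) h2
    refine (calc_t hα hβ hq hαβ hCu.le hu0 hv0 a1 a2).trans ?_
    have hP : 0 ≤ PP k ch ⟨i, K, hK⟩ x := PP_nonneg _ _
    unfold TT
    rw [Set.indicator_of_mem hxK]
    simp only [Pi.one_apply, mul_one]
    have hpi : 0 < α ^ i := by positivity
    calc Cu ^ q * Cv * α ^ i ≤ E * α * ((3:ℝ) ^ k)⁻¹ * α ^ i := by gcongr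
      _ = α ^ (i + 1) * (E * ((3:ℝ) ^ k)⁻¹) := by ring
      _ ≤ _ := by gcongr; linarith
  -- the minimal `K`
  have hex : ∃ n, ¬ ∃ K ∈ Kfam k n, ivSet I ⊆ ivSet K := by
    obtain ⟨n, hn⟩ := HH_small hk hlI
    refine ⟨n, ?_⟩
    rintro ⟨K, hK, h⟩
    have := len_le_of_sub hIp h
    rw [Kfam_len hk hK] at this
    linarith
  classical
  have hspec := Nat.find_spec hex
  have hmin := fun m => Nat.find_min (m := m) hex
  set n := Nat.find hex
  have hn0 : n ≠ 0 := by
    intro h0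
    rw [h0] at hspec
    exact hspec ⟨(0, 1), rfl, hI1⟩
  obtain ⟨i, hi⟩ := Nat.exists_eq_succ_of_ne_zero hn0
  rw [hi] at hspec hmin
  obtain ⟨K, hK, hIK⟩ := not_not.1 (hmin i (Nat.lt_succ_self i))
  have hKl := Kfam_len hk hK
  by_cases hlm : len I ≤ len (mid K)
  · rcases tri_nest hI (mid_tri hk hK) hlm with hm | hm
    · right
      obtain ⟨l, hl, hxl⟩ := mid_cover hk hK (hm hx)
      have hch : ∀ l, l < 3 ^ (k - 1) → ∀ y ∈ ivSet I, y ∈ ivSet (child k K l) →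
          ivSet (child k K l) ⊆ ivSet I := by
        intro l hl y hy hyl
        have hc := child_mem hK hl
        rcases le_total (len I) (len (child k K l)) with c | c
        · exact absurd ⟨_, hc, tri_nest_of_mem hI (Kfam_tri hk hc) c hy hyl⟩ hspec
        · exact tri_nest_of_mem (Kfam_tri hk hc) hI c hyl hy
      exact key (i + 1) _ (child_mem hK hl) hxl (hch l hl x hx hxl)
        (nu_mid hk hu hα hCu hCuα hK hm hch) (nu_mid hk hv hβ hCv hCvβ hK hm hch)
    · have n1 := nu_side hk hu hK hIK hm
      have n2 := nu_side hk hv hK hIK hm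
      rcases le_total (len I) (len (IJ k ch (mid K))) with c | c
      · left
        rcases tri_nest hI (A_tri hk hK ch) c with hA | hA
        · rw [hu.on i K hK x (hA hx)]
          rw [Set.inter_eq_left.2 hA, vol_iv, ← ENNReal.ofReal_mul (by positivity)] at n1 n2
          have a1 := avg_le hk hu hα hIp (by positivity) n1
          have a2 := avg_le hk hv hβ hIp (by positivity) n2
          have := calc_t (x := 1) (y := 1) (m := i + 1) hα hβ hq hαβ (by norm_num) hu0 hv0
            (by linarith) (by linarith)
          simpa using this
        · rw [Set.disjoint_iff_inter_eq_empty.1 hA, measure_empty, mul_zero] at n1 n2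
          have a2 : avg v I ≤ 0 := avg_le hk hv hβ hIp le_rfl (by simpa using n2)
          have : avg v I = 0 := le_antisymm a2 hv0
          rw [this, mul_zero]
          exact hu.nonneg hα x
      · rcases tri_nest (A_tri hk hK ch) hI c with hA | hA
        · right
          refine ⟨⟨i, K, hK⟩, hA, ?_⟩
          rw [Set.inter_eq_right.2 hA, vol_iv, ← ENNReal.ofReal_mul (by positivity)] at n1 n2
          have hAl := A_len hk hK ch
          set h := len (IJ k ch (mid K)) with hh
          have hhp : 0 < h := by rw [hAl]; exact HH_pos _ _
          have e : ∀ z : ℝ, z * h = (h / len I * z) * len I := by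
            intro z; field_simp
          rw [e] at n1 n2
          have a1 := avg_le hk hu hα hIp (by positivity) n1
          have a2 := avg_le hk hv hβ hIp (by positivity) n2
          set r := h / len I with hr
          have hr0 : 0 < r := by positivity
          have hr1 : r ≤ 1 := by rw [hr, div_le_one hlI]; exact c
          refine (calc_t hα hβ hq hαβ hr0.le hu0 hv0 a1 a2).trans ?_
          have hrq : r ^ q ≤ r := by
            calc r ^ q ≤ r ^ (1:ℝ) := Real.rpow_le_rpow_of_exponent_ge hr0 hr1 hq.le
              _ = r := Real.rpow_one r
          have hPb : r * r ≤ 2 * PP k ch ⟨i, K, hK⟩ x := by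
            unfold PP
            simp only []
            rw [← hAl]
            have hc : (AA k ch ⟨i, K, hK⟩).1 ∈ ivSet I := by
              apply hA
              unfold AA ivSet
              exact ⟨le_rfl, tri_pos (A_tri hk hK ch)⟩
            set cc := (AA k ch ⟨i, K, hK⟩).1
            unfold ivSet at hc hx
            have hd : (x - cc) ^ 2 ≤ (len I) ^ 2 := by
              apply sq_le_sq'
              · unfold len; linarith [hc.2, hx.1]
              · unfold len; linarith [hc.1, hx.2]
            rw [← div_eq_mul_inv, le_div_iff₀ (by positivity)]
            have e1 : r * r * (1 + ((x - cc) / h) ^ 2) = r * r + (x - cc) ^ 2 / len I ^ 2 := by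
              rw [hr]; field_simp
            rw [e1]
            have : (x - cc) ^ 2 / len I ^ 2 ≤ 1 := by
              rw [div_le_one (by positivity)]; exact hd
            nlinarith
          unfold TT
          have hind : 0 ≤ (ivSet K).indicator (1 : ℝ → ℝ) x :=
            Set.indicator_nonneg (fun _ _ => by simp) _
          calc r ^ q * r * α ^ (i + 1) ≤ r * r * α ^ (i + 1) := by gcongr
            _ ≤ (2 * PP k ch ⟨i, K, hK⟩ x) * α ^ (i + 1) := by gcongr
            _ ≤ _ := by
              rw [mul_comm]
              gcongr
              have : 0 ≤ E * ((3:ℝ) ^ k)⁻¹ * (ivSet K).indicator (1 : ℝ → ℝ) x := by positivity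
              simpa using this
        · left
          rw [Set.disjoint_iff_inter_eq_empty.1 hA.symm, measure_empty, mul_zero] at n1 n2
          have a2 : avg v I ≤ 0 := avg_le hk hv hβ hIp le_rfl (by simpa using n2)
          have : avg v I = 0 := le_antisymm a2 hv0
          rw [this, mul_zero]
          exact hu.nonneg hα x
  · right
    have hEq : I = K := by
      apply iv_eq_of_len hIp hIK
      obtain ⟨m, hm⟩ := tri_len hI
      obtain ⟨m', hm'⟩ := tri_len (Kfam_tri hk hK)
      push Not at hlm
      rw [len_mid, hm, hm', div_lt_iff₀ (by norm_num)] at hlm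
      rw [hm, hm']
      have h3 : (3:ℝ) ^ (-m) * 3 = 3 ^ (-m + 1) := by
        rw [zpow_add₀ (by norm_num), zpow_one]
      rw [h3] at hlm
      have := (zpow_lt_zpow_iff_right₀ (by norm_num : (1:ℝ) < 3)).1 hlm
      exact zpow_le_zpow_right₀ (by norm_num) (by omega)
    subst hEq
    refine key i I hK hx subset_rfl ?_ ?_
    · rw [hKl]; exact nu_K hk hu hα hCu hCuα hK
    · rw [hKl]; exact nu_K hk hv hβ hCv hCvβ hK

/-! ### Integration -/

theorem TT_nonneg {E : ℝ} (hα : 0 < α) (hE : 0 ≤ E) (κ : Idx k) (x : ℝ) :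
    0 ≤ TT k ch α E κ x := by
  have h1 : 0 ≤ (ivSet (κ.2 : ℝ × ℝ)).indicator (1 : ℝ → ℝ) x :=
    Set.indicator_nonneg (fun _ _ => by simp) _
  have h2 := PP_nonneg (ch := ch) κ x
  unfold TT; positivity

theorem PP_integrable (κ : Idx k) : Integrable (PP k ch κ) := by
  have h := (integrable_inv_one_add_sq.comp_div (HH_pos k (κ.1 + 1)).ne').comp_sub_right
    (AA k ch κ).1
  exact h

theorem PP_integral (κ : Idx k) : ∫ x, PP k ch κ x = Real.pi * HH k (κ.1 + 1) := by
  have hp := HH_pos k (κ.1 + 1)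
  have h1 := integral_sub_right_eq_self (μ := (volume : Measure ℝ))
    (fun x : ℝ => (1 + (x / HH k (κ.1 + 1)) ^ 2)⁻¹) (AA k ch κ).1
  have h2 := Measure.integral_comp_div (fun x : ℝ => (1 + x ^ 2)⁻¹) (HH k (κ.1 + 1))
  unfold PP
  rw [h1, h2, integral_univ_inv_one_add_sq, abs_of_pos hp, smul_eq_mul, mul_comm]

theorem TT_lint (hk : 1 ≤ k) (hf : IsW k ch α f) (hα : 0 < α) {E : ℝ} (hE : 0 ≤ E)
    (κ : Idx k) : ∫⁻ x, ENNReal.ofReal (TT k ch α E κ x) =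
      ENNReal.ofReal (E + 2 * Real.pi) * nu f (ivSet (AA k ch κ)) := by
  have hi1 : Integrable ((ivSet (κ.2 : ℝ × ℝ)).indicator (1 : ℝ → ℝ)) := by
    rw [integrable_indicator_iff (meas_iv _)]
    have : volume (ivSet (κ.2 : ℝ × ℝ)) ≠ ⊤ := by rw [vol_iv]; exact ENNReal.ofReal_ne_top
    exact integrableOn_const this
  have hi2 := PP_integrable (ch := ch) κ
  have hint1 : ∫ x, (ivSet (κ.2 : ℝ × ℝ)).indicator (1 : ℝ → ℝ) x = HH k κ.1 := by
    rw [integral_indicator_one (meas_iv _), Measure.real, vol_iv, Kfam_len hk κ.2.2,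
      ENNReal.toReal_ofReal (HH_pos _ _).le]
  have hi : Integrable (TT k ch α E κ) := by
    unfold TT
    exact ((hi1.const_mul _).add (hi2.const_mul _)).const_mul _
  have hint : ∫ x, TT k ch α E κ x = α ^ (κ.1 + 1) * ((E + 2 * Real.pi) * HH k (κ.1 + 1)) := by
    unfold TT
    rw [integral_const_mul, integral_add (hi1.const_mul _) (hi2.const_mul _), integral_const_mul,
      integral_const_mul, hint1, PP_integral, HH_succ]
    ring
  rw [← ofReal_integral_eq_lintegral_ofReal hi
    (Filter.Eventually.of_forall (TT_nonneg hα hE κ)), hint]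
  have hA : nu f (ivSet (AA k ch κ)) = ENNReal.ofReal (α ^ (κ.1 + 1) * HH k (κ.1 + 1)) := by
    unfold AA
    rw [nu_on hf κ.2.2 (meas_iv _) subset_rfl, vol_iv, A_len hk κ.2.2,
        ENNReal.ofReal_mul (by positivity)]
  have hpi := Real.pi_pos
  rw [hA, ← ENNReal.ofReal_mul (by positivity)]
  congr 1; ring

theorem TT_meas (α E : ℝ) (κ : Idx k) : Measurable fun x => ENNReal.ofReal (TT k ch α E κ x) := by
  apply Measurable.ennreal_ofReal
  unfold TT PP
  have : Measurable ((ivSet (κ.2 : ℝ × ℝ)).indicator (1 : ℝ → ℝ)) :=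
    measurable_one.indicator (meas_iv _)
  fun_prop

theorem TT_sum (hk : 1 ≤ k) (hf : IsW k ch α f) (hα : 0 < α) {E : ℝ} (hE : 0 ≤ E)
    (L : ℝ × ℝ) : ∫⁻ x, ∑' κ : {κ : Idx k // ivSet (AA k ch κ) ⊆ ivSet L},
      ENNReal.ofReal (TT k ch α E κ.1 x) ≤
      ENNReal.ofReal (E + 2 * Real.pi) * nu f (ivSet L) := by
  have hcnt := idx_countable k
  have h1 : ∫⁻ x, ∑' κ : {κ : Idx k // ivSet (AA k ch κ) ⊆ ivSet L},
      ENNReal.ofReal (TT k ch α E κ.1 x) =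
      ∑' κ : {κ : Idx k // ivSet (AA k ch κ) ⊆ ivSet L},
        ∫⁻ x, ENNReal.ofReal (TT k ch α E κ.1 x) :=
    lintegral_tsum fun κ => (TT_meas α E κ.1).aemeasurable
  have h2 : ∑' κ : {κ : Idx k // ivSet (AA k ch κ) ⊆ ivSet L},
        ∫⁻ x, ENNReal.ofReal (TT k ch α E κ.1 x) =
      ∑' κ : {κ : Idx k // ivSet (AA k ch κ) ⊆ ivSet L},
        ENNReal.ofReal (E + 2 * Real.pi) * nu f (ivSet (AA k ch κ.1)) :=
    tsum_congr fun κ => TT_lint hk hf hα hE κ.1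
  rw [h1, h2, ENNReal.tsum_mul_left]
  refine mul_le_mul_right ?_ _
  rw [← measure_iUnion]
  · exact measure_mono (Set.iUnion_subset fun κ => κ.2)
  · intro κ κ' hne
    rw [Function.onFun, Set.disjoint_left]
    intro x hx hx'
    exact hne (Subtype.ext (AA_uniq hk hx hx').symm)
  · intro κ; exact meas_iv _

theorem main_bound {k : ℕ} (hk : 1 ≤ k) {ch : ℝ × ℝ → Bool} {α β q : ℝ} {u v : ℝ → ℝ}
    (hu : IsW k ch α u) (hv : IsW k ch β v) (hα : 0 < α) (hβ : 0 < β) (hq : 1 < q)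
    (hαβ : α ^ q * β = α) {Cu Cv E : ℝ} (hCu : 0 < Cu) (hCv : 0 < Cv) (hE : 0 ≤ E)
    (hCuα : α * (1 + 3 ^ (k - 1) * Cu) ≤ 3 ^ k * Cu)
    (hCvβ : β * (1 + 3 ^ (k - 1) * Cv) ≤ 3 ^ k * Cv)
    (hD : Cu ^ q * Cv ≤ E * α * ((3:ℝ) ^ k)⁻¹)
    {ε : ℝ} (hε : 0 < ε) (hε1 : ε < 1) {S : Set (ℝ × ℝ)} (hS : MSparse ε S)
    (hST : ∀ I ∈ S, IsTriadic I ∧ ivSet I ⊆ Set.Ico (0 : ℝ) 1)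
    {L : ℝ × ℝ} (hL1 : ivSet L ⊆ Set.Ico (0 : ℝ) 1) :
    sumTest q u v {I | I ∈ S ∧ ivSet I ⊆ ivSet L} ≤
      (1 + (E + 2 * Real.pi)) * mass u L / (1 - ε) := by
  have hcnt := idx_countable k
  have hpi := Real.pi_pos
  have hT : ∀ I ∈ S, IsTriadic I := fun I hI => (hST I hI).1
  have hm0 : 0 ≤ mass u L := by rw [mass_eq hk hu hα]; positivity
  have hfin : nu u (ivSet L) ≠ ⊤ := by
    have h0 : ((0:ℝ), (1:ℝ)) ∈ Kfam k 0 := rfl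
    have := nu_K hk hu hα hCu hCuα h0
    exact (((measure_mono (show ivSet L ⊆ ivSet (0, 1) from hL1)).trans this).trans_lt
      ENNReal.ofReal_lt_top).ne
  let F : ℝ → ENNReal := fun x => ENNReal.ofReal (u x) +
    ∑' κ : {κ : Idx k // ivSet (AA k ch κ) ⊆ ivSet L}, ENNReal.ofReal (TT k ch α E κ.1 x)
  have hFint : ∫⁻ x in ivSet L, F x ≤
      ENNReal.ofReal (1 + (E + 2 * Real.pi)) * nu u (ivSet L) := by
    have hum : Measurable fun x => ENNReal.ofReal (u x) := (hu.measurable hk hα).ennreal_ofReal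
    rw [lintegral_add_left hum, ← nu_apply u (meas_iv L),
      ENNReal.ofReal_add (by norm_num) (by positivity), ENNReal.ofReal_one, add_mul, one_mul]
    gcongr
    exact (setLIntegral_le_lintegral _ _).trans (TT_sum hk hu hα hE L)
  have hpt : ∀ I ∈ S, ivSet I ⊆ ivSet L → ∀ x ∈ ivSet I,
      ENNReal.ofReal (avg u I ^ q * avg v I) ≤ F x := by
    intro I hI hIL x hx
    rcases pointwise hk hu hv hα hβ hq hαβ hCu hCv hE hCuα hCvβ hD (hT I hI) (hST I hI).2 hx
      with h | ⟨κ, h1, h2⟩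
    · exact (ENNReal.ofReal_le_ofReal h).trans le_self_add
    · refine (ENNReal.ofReal_le_ofReal h2).trans (le_trans ?_ le_add_self)
      exact ENNReal.le_tsum
        (f := fun κ : {κ : Idx k // ivSet (AA k ch κ) ⊆ ivSet L} =>
          ENNReal.ofReal (TT k ch α E κ.1 x)) ⟨κ, h1.trans hIL⟩
  have hε' : 0 < 1 - ε := by linarith
  unfold sumTest
  apply tsum_le_of_sum_le' (by positivity)
  intro s
  rw [le_div_iff₀ hε']
  have htn : ∀ I ∈ S, 0 ≤ avg u I ^ q * avg v I := by
    intro I hI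
    have h1 := avg_nonneg hk hu hα (tri_pos (hT I hI))
    have h2 := avg_nonneg hk hv hβ (tri_pos (hT I hI))
    positivity
  have hX : ENNReal.ofReal ((∑ I ∈ s, avg u (I : ℝ × ℝ) ^ q * avg v (I : ℝ × ℝ) *
      len (I : ℝ × ℝ)) * (1 - ε)) ≤ ENNReal.ofReal (1 + (E + 2 * Real.pi)) * nu u (ivSet L) := by
    refine le_trans ?_ hFint
    rw [Finset.sum_mul, ENNReal.ofReal_sum_of_nonneg]
    · have h1 : ∀ I ∈ s, ENNReal.ofReal (avg u (I : ℝ × ℝ) ^ q * avg v (I : ℝ × ℝ) *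
          len (I : ℝ × ℝ) * (1 - ε)) ≤ ∫⁻ x in EE S (I : ℝ × ℝ), F x := by
        rintro ⟨I, hI, hIL⟩ _
        simp only []
        rw [mul_assoc, ENNReal.ofReal_mul (htn I hI), mul_comm (len I)]
        calc _ ≤ ENNReal.ofReal (avg u I ^ q * avg v I) * volume (EE S I) := by
              gcongr; exact EE_vol hε hS hT hI
          _ = ∫⁻ x in EE S I, ENNReal.ofReal (avg u I ^ q * avg v I) := by
              rw [setLIntegral_const]
          _ ≤ _ := setLIntegral_mono' (EE_meas hS.1 I)
              fun x hx => hpt I hI hIL x (EE_sub S I hx)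
      refine (Finset.sum_le_sum h1).trans ?_
      rw [← lintegral_biUnion_finset]
      · apply lintegral_mono_set
        exact Set.iUnion₂_subset fun I _ => (EE_sub S _).trans I.2.2
      · intro I _ J _ hne
        exact EE_disj hS I.2.1 J.2.1 fun h => hne (Subtype.ext h)
      · intro I _; exact EE_meas hS.1 _
    · rintro ⟨I, hI, hIL⟩ _
      have h1 := htn I hI
      have h2 := len_pos_of (tri_pos (hT I hI))
      simp only []
      positivity
  rw [mass_eq hk hu hα]
  have hfin2 : ENNReal.ofReal (1 + (E + 2 * Real.pi)) * nu u (ivSet L) ≠ ⊤ :=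
    ENNReal.mul_ne_top ENNReal.ofReal_ne_top hfin
  have := (ENNReal.ofReal_le_iff_le_toReal hfin2).1 hX
  rwa [ENNReal.toReal_mul, ENNReal.toReal_ofReal (by positivity)] at this

end

/-- Proposition 4.5 (triadic case, local testing with constant independent of `k`):
for a martingale `ε`-sparse family of triadic subintervals of `[0,1)` and a triadic
`L ⊆ [0,1)`, the two localized testing sums are bounded by `C(p)·w_k(L)/(1-ε)`
and `C(p)·σ_k(L)/(1-ε)` respectively. -/
theorem statement6 (p : ℝ) (hp : 1 < p) :
    ∃ C : ℝ, 0 < C ∧ ∀ k : ℕ, 3000 < k → ∀ ch : ℝ × ℝ → Bool,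
      ∀ ε : ℝ, 0 < ε → ε < 1 → ∀ S : Set (ℝ × ℝ), MSparse ε S →
      (∀ I ∈ S, IsTriadic I ∧ ivSet I ⊆ Set.Ico (0 : ℝ) 1) →
      ∀ L : ℝ × ℝ, L.1 < L.2 → IsTriadic L → ivSet L ⊆ Set.Ico (0 : ℝ) 1 →
        sumTest p (wgt k ch) (sgm p k ch) {I | I ∈ S ∧ ivSet I ⊆ ivSet L} ≤
          C * mass (wgt k ch) L / (1 - ε) ∧
        sumTest (p / (p - 1)) (sgm p k ch) (wgt k ch) {I | I ∈ S ∧ ivSet I ⊆ ivSet L} ≤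
          C * mass (sgm p k ch) L / (1 - ε) := by
  have hpi := Real.pi_pos
  have h3p : 0 < (3:ℝ) ^ (p - 1) := by positivity
  refine ⟨1 + (3 / 2 * 3 ^ (p - 1) + 2 * Real.pi), by positivity, ?_⟩
  intro k hk3 ch ε hε hε1 S hS hST L hL hLT hL1
  have hk : 1 ≤ k := by omega
  have hM1 : (1:ℝ) ≤ 3 ^ (k - 1) := one_le_pow₀ (by norm_num)
  have h3k := three_pow hk
  have hw := wgt_isW hk ch
  have hs := sgm_isW hk ch p
  have h3p1 : 1 ≤ (3:ℝ) ^ (p - 1) := Real.one_le_rpow (by norm_num) (by linarith)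
  set a : ℝ := (3 : ℝ) ^ k / ((3 : ℝ) ^ (k - 1) + 1) with ha
  have ha1 : 1 ≤ a := by
    rw [ha, le_div_iff₀ (by positivity), h3k]; linarith
  have ha3 : a ≤ 3 := by
    rw [ha, div_le_iff₀ (by positivity), h3k]; linarith
  have ha0 : 0 < a := by linarith
  have hb0 : 0 < a ^ (1 - p) := by positivity
  have hb1 : a ^ (1 - p) ≤ 1 := Real.rpow_le_one_of_one_le_of_nonpos ha1 (by linarith)
  have hb3 : 1 ≤ (3:ℝ) ^ (p - 1) * a ^ (1 - p) := by
    have h1 : a ^ (p - 1) ≤ (3:ℝ) ^ (p - 1) := Real.rpow_le_rpow ha0.le ha3 (by linarith)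
    have h2 : a ^ (p - 1) * a ^ (1 - p) = 1 := by
      rw [← Real.rpow_add ha0]; simp
    calc (1:ℝ) = a ^ (p - 1) * a ^ (1 - p) := h2.symm
      _ ≤ _ := by gcongr
  have hCw : a * (1 + 3 ^ (k - 1) * 1) ≤ 3 ^ k * 1 := by
    rw [ha]; apply le_of_eq; field_simp; ring
  have hCs : a ^ (1 - p) * (1 + 3 ^ (k - 1) * (3 / 2 * ((3:ℝ) ^ k)⁻¹)) ≤
      3 ^ k * (3 / 2 * ((3:ℝ) ^ k)⁻¹) := by
    have e1 : (3:ℝ) ^ (k - 1) * (3 / 2 * ((3:ℝ) ^ k)⁻¹) = 1 / 2 := by rw [h3k]; field_simp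
    have e2 : (3:ℝ) ^ k * (3 / 2 * ((3:ℝ) ^ k)⁻¹) = 3 / 2 := by field_simp
    rw [e1, e2]; linarith
  have hinv : 0 < ((3:ℝ) ^ k)⁻¹ := by positivity
  have hp1 : 0 < p - 1 := by linarith
  have hq : 1 < p / (p - 1) := by rw [lt_div_iff₀ hp1]; linarith
  constructor
  · refine main_bound hk hw hs ha0 hb0 hp ?_ one_pos (by positivity) (by positivity) hCw hCs ?_
      hε hε1 hS hST hL1
    · rw [← Real.rpow_add ha0]; simp
    · rw [Real.one_rpow, one_mul]
      gcongr
      nlinarith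
  · refine main_bound hk hs hw hb0 ha0 hq ?_ (by positivity) one_pos (by positivity) hCs hCw ?_
      hε hε1 hS hST hL1
    · rw [← Real.rpow_mul ha0.le]
      nth_rewrite 2 [← Real.rpow_one a]
      rw [← Real.rpow_add ha0]
      congr 1; field_simp; ring
    · rw [mul_one]
      have hle : 3 / 2 * ((3:ℝ) ^ k)⁻¹ ≤ 1 := by
        rw [h3k, mul_inv]
        have := inv_le_one_of_one_le₀ hM1
        linarith
      calc (3 / 2 * ((3:ℝ) ^ k)⁻¹) ^ (p / (p - 1)) ≤ (3 / 2 * ((3:ℝ) ^ k)⁻¹) ^ (1:ℝ) :=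
            Real.rpow_le_rpow_of_exponent_ge (by positivity) hle hq.le
        _ = 3 / 2 * ((3:ℝ) ^ k)⁻¹ := Real.rpow_one _
        _ ≤ _ := by gcongr; nlinarith

end RTpaper
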